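/- Let S : ℝ × [0,T) → ℝ be a C⁴ function, 2π-periodic in θ, with S_θθ + S > 0, satisfying S_tt = ((S_θt)² − 1)·k where k = 1/(S_θθ + S), with initial data S_t(θ,0) = −f̃(θ) where f̃ ≥ 0, f̃ is not identically zero, and (f̃')² < 1 on ℝ. Then the length L(t) = ∫₀^{2π} (S_θθ(θ,t) + S(θ,t)) dθ satisfies L''(t) < 0 for all t ∈ [0,T) and L'(t) < 0 for all t ∈ (0,T); in particular L is strictly decreasing and strictly concave, so the length of the evolving curve reaches zero in finite time if the solution persists. -/

import Mathlib

open Real Set Function intervalIntegral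

/-- Partial derivative in the first (angle) variable. -/
noncomputable def pdθ (S : ℝ → ℝ → ℝ) : ℝ → ℝ → ℝ := fun θ t => deriv (fun y => S y t) θ

/-- Partial derivative in the second (time) variable. -/
noncomputable def pdt (S : ℝ → ℝ → ℝ) : ℝ → ℝ → ℝ := fun θ t => deriv (fun s => S θ s) t

/-- The curvature `k = 1/(S_θθ + S)` of the convex curve with support function `S(·,t)`. -/
noncomputable def curv (S : ℝ → ℝ → ℝ) : ℝ → ℝ → ℝ :=
  fun θ t => 1 / (pdθ (pdθ S) θ t + S θ t)

/-- The total length `L(t) = ∫₀^{2π} (S_θθ + S) dθ` of the evolving closed curve. -/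
noncomputable def curveLength (S : ℝ → ℝ → ℝ) (t : ℝ) : ℝ :=
  ∫ θ in (0:ℝ)..(2 * π), (pdθ (pdθ S) θ t + S θ t)

theorem hasDerivAt_slice_fst {G : ℝ → ℝ → ℝ} {θ t : ℝ}
    (hG : DifferentiableAt ℝ (uncurry G) (θ, t)) :
    HasDerivAt (fun y => G y t) (fderiv ℝ (uncurry G) (θ, t) (1, 0)) θ :=
  HasFDerivAt.comp_hasDerivAt (f := fun y : ℝ => (y, t)) θ hG.hasFDerivAt
    ((hasDerivAt_id θ).prodMk (hasDerivAt_const θ t))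

theorem hasDerivAt_slice_snd {G : ℝ → ℝ → ℝ} {θ t : ℝ}
    (hG : DifferentiableAt ℝ (uncurry G) (θ, t)) :
    HasDerivAt (fun s => G θ s) (fderiv ℝ (uncurry G) (θ, t) (0, 1)) t :=
  HasFDerivAt.comp_hasDerivAt (f := fun s : ℝ => (θ, s)) t hG.hasFDerivAt
    ((hasDerivAt_const t θ).prodMk (hasDerivAt_id t))

theorem hasDerivAt_pdθ {G : ℝ → ℝ → ℝ} {θ t : ℝ}
    (hG : DifferentiableAt ℝ (uncurry G) (θ, t)) :
    HasDerivAt (fun y => G y t) (pdθ G θ t) θ :=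
  (hasDerivAt_slice_fst hG).differentiableAt.hasDerivAt

theorem hasDerivAt_pdt {G : ℝ → ℝ → ℝ} {θ t : ℝ}
    (hG : DifferentiableAt ℝ (uncurry G) (θ, t)) :
    HasDerivAt (fun s => G θ s) (pdt G θ t) t :=
  (hasDerivAt_slice_snd hG).differentiableAt.hasDerivAt

theorem uncurry_pdθ_eq {G : ℝ → ℝ → ℝ} (hG : Differentiable ℝ (uncurry G)) :
    uncurry (pdθ G) = fun x => fderiv ℝ (uncurry G) x (1, 0) :=
  funext fun x => (hasDerivAt_slice_fst (hG x)).deriv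

theorem uncurry_pdt_eq {G : ℝ → ℝ → ℝ} (hG : Differentiable ℝ (uncurry G)) :
    uncurry (pdt G) = fun x => fderiv ℝ (uncurry G) x (0, 1) :=
  funext fun x => (hasDerivAt_slice_snd (hG x)).deriv

theorem contDiff_pdθ {G : ℝ → ℝ → ℝ} {n : WithTop ℕ∞} (hG : ContDiff ℝ (n + 1) (uncurry G)) :
    ContDiff ℝ n (uncurry (pdθ G)) := by
  rw [uncurry_pdθ_eq (hG.differentiable (by simp))]
  exact (hG.fderiv_right le_rfl).clm_apply contDiff_const

theorem contDiff_pdt {G : ℝ → ℝ → ℝ} {n : WithTop ℕ∞} (hG : ContDiff ℝ (n + 1) (uncurry G)) :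
    ContDiff ℝ n (uncurry (pdt G)) := by
  rw [uncurry_pdt_eq (hG.differentiable (by simp))]
  exact (hG.fderiv_right le_rfl).clm_apply contDiff_const

/-- Mixed partial derivatives of a `C²` function commute. -/
theorem pdt_pdθ_comm {G : ℝ → ℝ → ℝ} (hG : ContDiff ℝ 2 (uncurry G)) :
    pdt (pdθ G) = pdθ (pdt G) := by
  have hd : Differentiable ℝ (uncurry G) := hG.differentiable (by simp)
  have hG' : ContDiff ℝ (1 + 1) (uncurry G) := by rwa [one_add_one_eq_two]
  have hf : Differentiable ℝ (fderiv ℝ (uncurry G)) :=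
    (hG'.fderiv_right le_rfl).differentiable (by simp)
  funext θ t
  have h1 := (hasDerivAt_slice_snd ((contDiff_pdθ hG').differentiable (by simp) (θ, t))).deriv
  have h2 := (hasDerivAt_slice_fst ((contDiff_pdt hG').differentiable (by simp) (θ, t))).deriv
  rw [uncurry_pdθ_eq hd, fderiv_clm_apply (hf _) (differentiableAt_const _)] at h1
  rw [uncurry_pdt_eq hd, fderiv_clm_apply (hf _) (differentiableAt_const _)] at h2
  have hsymm := (hG.contDiffAt (x := (θ, t))).isSymmSndFDerivAt (by simp) (0, 1) (1, 0)
  change deriv (fun s => pdθ G θ s) t = deriv (fun y => pdt G y t) θ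
  rw [h1, h2]
  simpa using hsymm

theorem pdθ_add_period {G : ℝ → ℝ → ℝ} {P : ℝ} (hG : ∀ θ t, G (θ + P) t = G θ t) (θ t : ℝ) :
    pdθ G (θ + P) t = pdθ G θ t := by
  simp only [pdθ]
  rw [← deriv_comp_add_const]
  simp only [hG]

theorem pdt_add_period {G : ℝ → ℝ → ℝ} {P : ℝ} (hG : ∀ θ t, G (θ + P) t = G θ t) (θ t : ℝ) :
    pdt G (θ + P) t = pdt G θ t := by
  simp only [pdt, hG]

/-- Differentiation under the integral sign for a `C¹` integrand. -/
theorem hasDerivAt_integral_pdt {G : ℝ → ℝ → ℝ} (hG : ContDiff ℝ 1 (uncurry G)) (a b t : ℝ) :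
    HasDerivAt (fun s => ∫ θ in a..b, G θ s) (∫ θ in a..b, pdt G θ t) t := by
  have hGc : Continuous (uncurry G) := hG.continuous
  have hpc : Continuous (uncurry (pdt G)) := (contDiff_pdt (n := 0) (by simpa using hG)).continuous
  have hslice (s : ℝ) : Continuous fun θ => G θ s := hGc.comp (by fun_prop : Continuous (·, s))
  have hslice' (s : ℝ) : Continuous fun θ => pdt G θ s :=
    hpc.comp (by fun_prop : Continuous (·, s))
  obtain ⟨C, hC⟩ := (isCompact_uIcc.prod (isCompact_closedBall t 1)).exists_bound_of_continuousOn
    (s := uIcc a b ×ˢ Metric.closedBall t 1) hpc.continuousOn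
  refine (hasDerivAt_integral_of_dominated_loc_of_deriv_le (F := fun s θ => G θ s)
    (F' := fun s θ => pdt G θ s) (bound := fun _ => C)
    (Metric.closedBall_mem_nhds t one_pos) (.of_forall fun s => (hslice s).aestronglyMeasurable)
    ((hslice t).intervalIntegrable a b) (hslice' t).aestronglyMeasurable
    (.of_forall fun θ hθ s hs => hC (θ, s) ⟨uIoc_subset_uIcc hθ, hs⟩)
    intervalIntegrable_const (.of_forall fun θ _ s _ => ?_)).2
  exact hasDerivAt_pdt (hG.differentiable (by simp) (θ, s))

/-- A function with a positive derivative at `x` takes values smaller than its value at `x`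
immediately to the left of `x`. -/
theorem exists_lt_of_hasDerivAt_pos {u : ℝ → ℝ} {a x u' : ℝ} (hu : HasDerivAt u u' x)
    (hu' : 0 < u') (hax : a < x) : ∃ y ∈ Ioo a x, u y < u x := by
  have hd : deriv (fun y => u y - u x) x > 0 := by simpa [hu.deriv] using hu'
  have hev := eventually_nhdsWithin_sign_eq_of_deriv_pos hd (sub_self _)
  have hleft : ∀ᶠ y in nhdsWithin x (Iio x), SignType.sign (u y - u x) = SignType.sign (y - x) :=
    nhdsWithin_le_nhds hev
  obtain ⟨y, hy, hya⟩ := (hleft.and (Ioo_mem_nhdsLT hax)).exists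
  refine ⟨y, hya, ?_⟩
  rw [sign_neg (sub_neg.2 hya.2), sign_eq_neg_one_iff] at hy
  exact sub_neg.1 hy

/-- A minimum principle: a periodic function which is initially nonnegative and solves
`h_t = c h` at its spatial critical points stays nonnegative. -/
theorem nonneg_of_pdt_eq_mul_of_pdθ_eq_zero {h c : ℝ → ℝ → ℝ} {P T : ℝ} (hP : 0 < P)
    (hh : ContDiff ℝ 1 (uncurry h)) (hper : ∀ θ t, h (θ + P) t = h θ t)
    (h0 : ∀ θ, 0 ≤ h θ 0) (hc : ContinuousOn (uncurry c) (univ ×ˢ Icc 0 T))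
    (hcrit : ∀ θ, ∀ t ∈ Icc 0 T, pdθ h θ t = 0 → pdt h θ t = c θ t * h θ t)
    (θ t : ℝ) (ht : t ∈ Icc 0 T) : 0 ≤ h θ t := by
  have hcpt : IsCompact (Icc 0 P ×ˢ Icc 0 T) := isCompact_Icc.prod isCompact_Icc
  obtain ⟨C, hC⟩ := hcpt.exists_bound_of_continuousOn
    (hc.mono (prod_mono (subset_univ _) subset_rfl))
  have hcont := hh.continuous
  have hw : Continuous fun x : ℝ × ℝ => Real.exp (-(C + 1) * x.2) * uncurry h x := by fun_prop
  obtain ⟨⟨θm, tm⟩, ⟨hθm, htm⟩, hmin⟩ := hcpt.exists_isMinOn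
    ⟨(0, t), ⟨⟨le_rfl, hP.le⟩, ht⟩⟩ hw.continuousOn
  have hmin' (y s : ℝ) (hs : s ∈ Icc 0 T) :
      Real.exp (-(C + 1) * tm) * h θm tm ≤ Real.exp (-(C + 1) * s) * h y s := by
    obtain ⟨z, hz, hzy⟩ := (show Periodic (fun y => h y s) P from fun y => hper y s).exists_mem_Ico₀
      hP y
    have := hmin (show (z, s) ∈ Icc 0 P ×ˢ Icc 0 T from ⟨Ico_subset_Icc_self hz, hs⟩)
    rw [show h y s = h z s from hzy]
    exact this
  suffices hm : 0 ≤ h θm tm by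
    have := (mul_nonneg (Real.exp_pos _).le hm).trans (hmin' θ t ht)
    exact nonneg_of_mul_nonneg_right this (Real.exp_pos _)
  by_contra! hneg
  have htm0 : 0 < tm := by
    refine htm.1.lt_of_ne fun htm' => ?_
    obtain rfl : 0 = tm := htm'
    exact absurd (h0 θm) hneg.not_ge
  have hθ0 : pdθ h θm tm = 0 := by
    have : IsLocalMin (fun y => h y tm) θm :=
      .of_forall fun y => le_of_mul_le_mul_left (hmin' y tm htm) (Real.exp_pos _)
    exact this.deriv_eq_zero
  have hdt := hasDerivAt_pdt (hh.differentiable (by simp) (θm, tm))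
  rw [hcrit θm tm htm hθ0] at hdt
  have hde : HasDerivAt (fun s => Real.exp (-(C + 1) * s))
      (Real.exp (-(C + 1) * tm) * (-(C + 1))) tm := by
    simpa using ((hasDerivAt_id tm).const_mul (-(C + 1))).exp
  have hcb : c θm tm ≤ C := (le_abs_self _).trans (hC (θm, tm) ⟨hθm, htm⟩)
  obtain ⟨s, hs, hlt⟩ := exists_lt_of_hasDerivAt_pos (hde.mul hdt) (by
    have he := Real.exp_pos (-(C + 1) * tm)
    have : 0 < Real.exp (-(C + 1) * tm) * ((c θm tm - (C + 1)) * h θm tm) :=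
      mul_pos he (mul_pos_of_neg_of_neg (by linarith) hneg)
    linarith) htm0
  exact absurd (hmin' θm s ⟨hs.1.le, hs.2.le.trans htm.2⟩) (not_le.2 hlt)

/-- The gradient bound `(S_θt)² ≤ 1` is preserved by the hyperbolic mean curvature flow. -/
theorem sq_pdθ_pdt_le_one {T : ℝ} {S : ℝ → ℝ → ℝ} {P : ℝ} (hP : 0 < P)
    (hS : ContDiff ℝ 4 (uncurry S)) (hper : ∀ θ t, S (θ + P) t = S θ t)
    (hconv : ∀ θ t, t ∈ Ico (0 : ℝ) T → 0 < pdθ (pdθ S) θ t + S θ t)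
    (hpde : ∀ θ t, t ∈ Ico (0 : ℝ) T →
      pdt (pdt S) θ t = ((pdθ (pdt S) θ t) ^ 2 - 1) * curv S θ t)
    (hinit : ∀ θ, (pdθ (pdt S) θ 0) ^ 2 ≤ 1) (θ t : ℝ) (ht : t ∈ Ico 0 T) :
    (pdθ (pdt S) θ t) ^ 2 ≤ 1 := by
  have hSt : ContDiff ℝ 3 (uncurry (pdt S)) := contDiff_pdt (by norm_num; exact hS)
  have hp : ContDiff ℝ 2 (uncurry (pdθ (pdt S))) := contDiff_pdθ (by norm_num; exact hSt)
  have hSθ : ContDiff ℝ 3 (uncurry (pdθ S)) := contDiff_pdθ (by norm_num; exact hS)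
  have hSθθ : ContDiff ℝ 2 (uncurry (pdθ (pdθ S))) := contDiff_pdθ (by norm_num; exact hSθ)
  set p := pdθ (pdt S) with hp_def
  set r : ℝ → ℝ → ℝ := fun θ t => pdθ (pdθ S) θ t + S θ t with hr_def
  have hr : ContDiff ℝ 2 (uncurry r) := hSθθ.add (hS.of_le (by norm_num))
  have hrθ : ContDiff ℝ 1 (uncurry (pdθ r)) := contDiff_pdθ (by norm_num; exact hr)
  have hh : ContDiff ℝ 1 (uncurry fun θ t => 1 - p θ t ^ 2) :=
    contDiff_const.sub ((hp.of_le (by norm_num)).pow 2)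
  have key := nonneg_of_pdt_eq_mul_of_pdθ_eq_zero (T := t)
    (c := fun θ t => -2 * p θ t * pdθ r θ t / r θ t ^ 2) hP hh
    (fun θ t => by simp only [hp_def, pdθ_add_period (pdt_add_period hper)])
    (fun θ => sub_nonneg.2 (hinit θ)) ?_ ?_ θ t ⟨ht.1, le_rfl⟩
  · linarith
  · refine ContinuousOn.div ?_ (hr.continuous.pow 2).continuousOn fun x hx =>
      (pow_pos (hconv x.1 x.2 ⟨hx.2.1, hx.2.2.trans_lt ht.2⟩) 2).ne'
    exact ((continuous_const.mul hp.continuous).mul hrθ.continuous).continuousOn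
  · intro y s hs hcrit
    have hs' : s ∈ Ico 0 T := ⟨hs.1, hs.2.trans_lt ht.2⟩
    have hr0 : r y s ≠ 0 := (hconv y s hs').ne'
    have hpθ := hasDerivAt_pdθ (hp.differentiable (by simp) (y, s))
    have hpt := hasDerivAt_pdt (hp.differentiable (by simp) (y, s))
    have hrd := hasDerivAt_pdθ (hr.differentiable (by simp) (y, s))
    have hcrit' : p y s * pdθ p y s = 0 := by
      have := ((hpθ.pow 2).const_sub 1).deriv
      change pdθ (fun θ t => 1 - p θ t ^ 2) y s = _ at this
      rw [hcrit] at this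
      simpa using this
    have hpt_eq : pdt p y s
        = (2 * p y s * pdθ p y s * r y s - (p y s ^ 2 - 1) * pdθ r y s) / r y s ^ 2 := by
      rw [hp_def, pdt_pdθ_comm (hSt.of_le (by norm_num)), ← hp_def]
      have hfun : (fun z => pdt (pdt S) z s) = fun z => (p z s ^ 2 - 1) / r z s :=
        funext fun z => by rw [hpde z s hs', curv, mul_one_div]
      have := (((hpθ.pow 2).sub_const 1).div hrd hr0).deriv
      change deriv (fun z => pdt (pdt S) z s) y = _
      rw [hfun]
      refine Eq.trans this ?_
      simp
    have := ((hpt.pow 2).const_sub 1).deriv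
    change pdt (fun θ t => 1 - p θ t ^ 2) y s = _ at this
    rw [this, hpt_eq]
    field_simp
    push_cast
    linear_combination (-4 * p y s * r y s) * hcrit'

theorem curveLength_eq_integral {S : ℝ → ℝ → ℝ} (hS : ContDiff ℝ 2 (uncurry S))
    (hper : ∀ θ t, S (θ + 2 * π) t = S θ t) :
    curveLength S = fun t => ∫ θ in (0 : ℝ)..(2 * π), S θ t := by
  have hSθ : ContDiff ℝ 1 (uncurry (pdθ S)) := contDiff_pdθ (by norm_num; exact hS)
  have hSθθ : ContDiff ℝ 0 (uncurry (pdθ (pdθ S))) := contDiff_pdθ (by simpa using hSθ)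
  funext t
  have hc1 : Continuous fun θ => pdθ (pdθ S) θ t :=
    hSθθ.continuous.comp (by fun_prop : Continuous (·, t))
  have hc2 : Continuous fun θ => S θ t := hS.continuous.comp (by fun_prop : Continuous (·, t))
  rw [curveLength, integral_add (hc1.intervalIntegrable _ _) (hc2.intervalIntegrable _ _),
    integral_eq_sub_of_hasDerivAt (f := fun θ => pdθ S θ t)
      (fun θ _ => hasDerivAt_pdθ (hSθ.differentiable (by simp) (θ, t)))
      (hc1.intervalIntegrable _ _)]
  have := pdθ_add_period hper 0 t
  rw [zero_add] at this
  rw [this, sub_self, zero_add]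

/-- Along the hyperbolic mean curvature flow `S_tt = ((S_θt)² − 1)·k`, with initial normal
velocity `f̃ ≥ 0` not identically zero and `(f̃')² < 1`, the length of the evolving curve
satisfies `L''(t) < 0` on `[0,T)` and `L'(t) < 0` on `(0,T)`: `L` is strictly decreasing
and strictly concave. -/
theorem length_strictly_decreasing_and_concave
    (T : ℝ) (S : ℝ → ℝ → ℝ) (f : ℝ → ℝ)
    (hS : ContDiff ℝ 4 (uncurry S))
    (hper : ∀ θ t, S (θ + 2 * π) t = S θ t)
    (hconv : ∀ θ t, t ∈ Ico (0:ℝ) T → 0 < pdθ (pdθ S) θ t + S θ t)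
    (hpde : ∀ θ t, t ∈ Ico (0:ℝ) T →
      pdt (pdt S) θ t = ((pdθ (pdt S) θ t) ^ 2 - 1) * curv S θ t)
    (hinitvel : ∀ θ, pdt S θ 0 = - f θ)
    (hfnonneg : ∀ θ, 0 ≤ f θ)
    (hfne : ∃ θ, f θ ≠ 0)
    (hfgrad : ∀ θ, (deriv f θ) ^ 2 < 1) :
    (∀ t ∈ Ico (0:ℝ) T, deriv (deriv (curveLength S)) t < 0) ∧
    (∀ t ∈ Ioo (0:ℝ) T, deriv (curveLength S) t < 0) := by
  have hSt : ContDiff ℝ 3 (uncurry (pdt S)) := contDiff_pdt (by norm_num; exact hS)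
  have hStt : ContDiff ℝ 2 (uncurry (pdt (pdt S))) := contDiff_pdt (by norm_num; exact hSt)
  have hL' : deriv (curveLength S) = fun t => ∫ θ in (0 : ℝ)..(2 * π), pdt S θ t := by
    rw [curveLength_eq_integral (hS.of_le (by norm_num)) hper]
    exact funext fun t => (hasDerivAt_integral_pdt (hS.of_le (by norm_num)) _ _ t).deriv
  have hL'' (t : ℝ) := hasDerivAt_integral_pdt (hSt.of_le (by norm_num)) 0 (2 * π) t
  have hinit (θ : ℝ) : (pdθ (pdt S) θ 0) ^ 2 ≤ 1 := by
    simp only [pdθ, hinitvel, deriv.fun_neg, neg_sq]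
    exact (hfgrad θ).le
  have hconcave : ∀ t ∈ Ico (0 : ℝ) T, deriv (deriv (curveLength S)) t < 0 := by
    intro t ht
    rw [hL', (hL'' t).deriv]
    have hcont : Continuous fun θ => pdt (pdt S) θ t :=
      hStt.continuous.comp (by fun_prop : Continuous (·, t))
    have hcont' : Continuous fun θ => pdt S θ t :=
      hSt.continuous.comp (by fun_prop : Continuous (·, t))
    have hk (θ : ℝ) : 0 < curv S θ t := one_div_pos.2 (hconv θ t ht)
    obtain ⟨θ₀, hθ₀, hcrit⟩ := exists_deriv_eq_zero (f := fun θ => pdt S θ t) two_pi_pos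
      hcont'.continuousOn (by simpa using (pdt_add_period hper 0 t).symm)
    have hlt := integral_lt_integral_of_continuousOn_of_le_of_exists_lt two_pi_pos
      hcont.continuousOn (continuousOn_const (c := (0 : ℝ))) (fun θ _ => ?_)
      ⟨θ₀, Ioo_subset_Icc_self hθ₀, ?_⟩
    · simpa using hlt
    · rw [hpde θ t ht]
      exact mul_nonpos_of_nonpos_of_nonneg
        (sub_nonpos.2 (sq_pdθ_pdt_le_one two_pi_pos hS hper hconv hpde hinit θ t ht)) (hk θ).le
    · rw [hpde θ₀ t ht, show pdθ (pdt S) θ₀ t = 0 from hcrit]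
      linarith [hk θ₀]
  refine ⟨hconcave, fun t ht => ?_⟩
  have hanti : StrictAntiOn (deriv (curveLength S)) (Icc 0 t) := by
    refine strictAntiOn_of_deriv_neg (convex_Icc _ _) ?_ fun s hs => ?_
    · rw [hL']
      exact fun s _ => (hL'' s).continuousAt.continuousWithinAt
    · rw [interior_Icc] at hs
      exact hconcave s ⟨hs.1.le, hs.2.trans ht.2⟩
  refine (hanti ⟨le_rfl, ht.1.le⟩ ⟨ht.1.le, le_rfl⟩ ht.1).trans_le ?_
  simp only [hL', hinitvel, integral_neg]
  exact neg_nonpos.2 (integral_nonneg two_pi_pos.le fun θ _ => hfnonneg θ)
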